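/- arXiv:2312.09931 — 3 statements merged into one kernel-verified Lean document; each statement's English description precedes it below -/
import Mathlib

section
/- Let k ∈ ℕ₀ and m ∈ {2,3,…,n} be fixed, let {p_j} be a sequence of monic real polynomials with deg p_j = j that is orthogonal on (a,b) with respect to the weight w(x) > 0, let c_{2k} be an even real polynomial of exact degree 2k with c_{2k}(x)w(x) > 0 on (a,b), and let {g_{j,k}} be a sequence of monic real polynomials with deg g_{j,k} = j that is orthogonal on (a,b) with respect to c_{2k}(x)w(x). Then there exist real polynomials a_{2k−m} and G such that c_{2k}(x)·g_{n−m,k}(x) = a_{2k−m}(x)·p_n(x) − G(x)·p_{n−1}(x) for all x, where deg(G) = max{m−1, 2k−m−1}, and deg(a_{2k−m}) = m−2 if k ∈ {0,1,…,m−1} while deg(a_{2k−m}) = 2k−m if k ∈ {m, m+1, …}. In particular, deg(G) = m−1 if and only if k ∈ {0,1,2,…,m}. -/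
open MeasureTheory Polynomial

/-- Nonzero polynomials that are nonnegative on `S` have positive image under `L`. -/
def IsPosFunctional (L : ℝ[X] →ₗ[ℝ] ℝ) (S : Set ℝ) : Prop :=
  ∀ f : ℝ[X], f ≠ 0 → (∀ x ∈ S, 0 ≤ f.eval x) → 0 < L f

/-- `p` is the sequence of monic orthogonal polynomials of the functional `L`. -/
structure IsMonicOrthogonal (L : ℝ[X] →ₗ[ℝ] ℝ) (p : ℕ → ℝ[X]) : Prop where
  monic : ∀ j, (p j).Monic
  natDegree : ∀ j, (p j).natDegree = j
  orth : ∀ i j, i ≠ j → L (p i * p j) = 0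

namespace IsMonicOrthogonal

variable {L : ℝ[X] →ₗ[ℝ] ℝ} {p : ℕ → ℝ[X]} {S : Set ℝ}

theorem degree (hp : IsMonicOrthogonal L p) (j : ℕ) : (p j).degree = j := by
  rw [degree_eq_natDegree (hp.monic j).ne_zero, hp.natDegree]

theorem coeff_self (hp : IsMonicOrthogonal L p) (j : ℕ) : (p j).coeff j = 1 := by
  simpa [Monic, leadingCoeff, hp.natDegree] using hp.monic j

theorem degree_sub_lt (hp : IsMonicOrthogonal L p) {u : ℝ[X]} {d : ℕ}
    (hu : u.degree < (d + 1 : ℕ)) :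
    (u - C (u.coeff d) * p d).degree < d := by
  rw [degree_lt_iff_coeff_zero] at hu ⊢
  intro i hi
  rcases hi.eq_or_lt with rfl | hi
  · simp [hp.coeff_self]
  · rw [coeff_sub, coeff_C_mul, hu i hi,
      coeff_eq_zero_of_natDegree_lt (p := p d) (by rw [hp.natDegree]; exact hi)]
    simp

theorem mul_eq_zero_of_forall_lt (hp : IsMonicOrthogonal L p) {q : ℝ[X]} {d : ℕ}
    (hq : ∀ i < d, L (q * p i) = 0) {u : ℝ[X]} (hu : u.degree < d) : L (q * u) = 0 := by
  induction d generalizing u with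
  | zero =>
    have : u = 0 := by simpa [Nat.WithBot.lt_zero_iff] using hu
    simp [this]
  | succ d ih =>
    have h := ih (fun i hi => hq i (by omega)) (hp.degree_sub_lt hu)
    have e : q * u = q * (u - C (u.coeff d) * p d) + u.coeff d • (q * p d) := by
      rw [smul_eq_C_mul]; ring
    rw [e, map_add, map_smul, h, hq d (by omega)]
    simp

theorem orth_of_degree_lt (hp : IsMonicOrthogonal L p) {j : ℕ} {u : ℝ[X]} (hu : u.degree < j) :
    L (p j * u) = 0 :=
  hp.mul_eq_zero_of_forall_lt (fun i hi => hp.orth j i hi.ne') hu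

theorem apply_mul_of_degree_lt (hp : IsMonicOrthogonal L p) {j : ℕ} {u : ℝ[X]}
    (hu : u.degree < (j + 1 : ℕ)) : L (p j * u) = u.coeff j * L (p j ^ 2) := by
  have h := hp.orth_of_degree_lt (hp.degree_sub_lt hu)
  have e : p j * u = p j * (u - C (u.coeff j) * p j) + u.coeff j • (p j ^ 2) := by
    rw [smul_eq_C_mul]; ring
  rw [e, map_add, map_smul, h]
  simp

theorem norm_pos (hp : IsMonicOrthogonal L p) (hL : IsPosFunctional L S) (j : ℕ) :
    0 < L (p j ^ 2) :=
  hL _ (pow_ne_zero _ (hp.monic j).ne_zero) fun x _ => by rw [eval_pow]; positivity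

theorem eq_zero_of_forall_lt (hp : IsMonicOrthogonal L p) (hL : IsPosFunctional L S)
    {q : ℝ[X]} {d : ℕ} (hq : ∀ i < d, L (q * p i) = 0) (hd : q.degree < d) : q = 0 := by
  by_contra h
  have h1 := hp.mul_eq_zero_of_forall_lt hq hd
  have h2 := hL (q * q) (mul_ne_zero h h) fun x _ => by
    rw [eval_mul]; exact mul_self_nonneg _
  exact h2.ne' h1

/-- A polynomial of degree less than `d` orthogonal to `p 0, …, p (N - 1)` lies in every
subspace containing `p N, …, p (d - 1)`. -/
theorem mem_of_forall_mem (hp : IsMonicOrthogonal L p) (hL : IsPosFunctional L S) {N d : ℕ}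
    (hNd : N ≤ d) {W : Submodule ℝ ℝ[X]} (hW : ∀ j, N ≤ j → j < d → p j ∈ W) {F : ℝ[X]}
    (hF : F.degree < d) (horth : ∀ i < N, L (F * p i) = 0) : F ∈ W := by
  induction d, hNd using Nat.le_induction generalizing F with
  | base => rw [hp.eq_zero_of_forall_lt hL horth hF]; exact W.zero_mem
  | succ d hd ih =>
    have e : F = (F - C (F.coeff d) * p d) + F.coeff d • p d := by
      rw [smul_eq_C_mul]; ring
    rw [e]
    refine W.add_mem (ih (fun j h1 h2 => hW j h1 (by omega)) (hp.degree_sub_lt hF) ?_)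
      (W.smul_mem _ (hW d hd (by omega)))
    intro i hi
    have e' : (F - C (F.coeff d) * p d) * p i = F * p i - F.coeff d • (p d * p i) := by
      rw [smul_eq_C_mul]; ring
    rw [e', map_sub, map_smul, horth i hi, hp.orth d i (by omega)]
    simp

/-- The three-term recurrence. -/
theorem exists_recurrence (hp : IsMonicOrthogonal L p) (hL : IsPosFunctional L S) (j : ℕ) :
    ∃ β : ℝ, p (j + 2) = (X - C β) * p (j + 1) -
      C (L (p (j + 1) ^ 2) / L (p j ^ 2)) * p j := by
  have h0 := (hp.norm_pos hL j).ne'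
  have h1 := (hp.norm_pos hL (j + 1)).ne'
  set h := fun j => L (p j ^ 2) with hh
  set β := L (p (j + 1) * (X * p (j + 1))) / h (j + 1) with hβ
  refine ⟨β, ?_⟩
  have hX : ∀ i, (X * p i).degree = ((i + 1 : ℕ) : WithBot ℕ) := fun i => by
    rw [degree_mul, degree_X, hp.degree, add_comm]; rfl
  set q := (X - C β) * p (j + 1) - C (h (j + 1) / h j) * p j - p (j + 2) with hq
  suffices q = 0 from (sub_eq_zero.1 this).symm
  refine hp.eq_zero_of_forall_lt hL (d := j + 2) ?_ ?_
  · intro i hi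
    have e : q * p i = p (j + 1) * (X * p i) - β • (p (j + 1) * p i) -
        (h (j + 1) / h j) • (p j * p i) - p (j + 2) * p i := by
      rw [hq, smul_eq_C_mul, smul_eq_C_mul]; ring
    rw [e, map_sub, map_sub, map_sub, map_smul, map_smul, hp.orth (j + 2) i (by omega)]
    rcases Nat.lt_or_ge i j with hij | hij
    · rw [hp.orth_of_degree_lt (by rw [hX]; exact_mod_cast by omega), hp.orth (j + 1) i (by omega),
        hp.orth j i (by omega)]
      simp
    · obtain rfl | rfl : i = j ∨ i = j + 1 := by omega
      · rw [hp.apply_mul_of_degree_lt (by rw [hX]; exact_mod_cast by omega),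
          hp.orth (i + 1) i (by omega), coeff_X_mul, hp.coeff_self, ← pow_two]
        simp only [hh, smul_eq_mul]
        field_simp
        ring
      · rw [hp.orth j (j + 1) (by omega), ← pow_two, hβ]
        simp only [hh, smul_eq_mul]
        field_simp
        ring
  · rw [degree_lt_iff_coeff_zero]
    intro i hi
    have hz : ∀ l < i, (p l).coeff i = 0 := fun l hl =>
      coeff_eq_zero_of_natDegree_lt (by rw [hp.natDegree]; exact hl)
    obtain ⟨i, rfl⟩ : ∃ i', i = i' + 1 := ⟨i - 1, by omega⟩
    have : q = X * p (j + 1) - C β * p (j + 1) - C (h (j + 1) / h j) * p j - p (j + 2) := by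
      rw [hq]; ring
    rw [this]
    simp only [coeff_sub, coeff_X_mul, coeff_C_mul]
    rw [hz j (by omega), hz (j + 1) (by omega)]
    rcases hi.eq_or_lt with hi | hi
    · obtain rfl : i = j + 1 := by omega
      simp [hp.coeff_self]
    · rw [hz (j + 2) (by omega), coeff_eq_zero_of_natDegree_lt (by rw [hp.natDegree]; omega)]
      simp

theorem not_nonneg_dvd (hp : IsMonicOrthogonal L p) (hL : IsPosFunctional L S) {M : ℕ}
    {q : ℝ[X]} (hq : 0 < q.degree) (hqS : ∀ x ∈ S, 0 ≤ q.eval x) : ¬ q ∣ p M := by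
  rintro ⟨h, hh⟩
  have hq0 : q ≠ 0 := by rintro rfl; simp at hq
  have hh0 : h ≠ 0 := by rintro rfl; exact (hp.monic M).ne_zero (by simpa using hh)
  have hdeg : h.degree < M := by
    have := congrArg Polynomial.natDegree hh
    rw [hp.natDegree, natDegree_mul hq0 hh0] at this
    rw [← natDegree_lt_iff_degree_lt hh0]
    have := natDegree_pos_iff_degree_pos.2 hq
    omega
  have h1 := hp.orth_of_degree_lt hdeg
  have h2 := hL (q * (h * h)) (by simp [hq0, hh0]) fun x hx => by
    rw [eval_mul, eval_mul]; exact mul_nonneg (hqS x hx) (mul_self_nonneg _)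
  rw [hh, mul_assoc] at h1
  exact h2.ne' h1

theorem splits (hp : IsMonicOrthogonal L p) (hL : IsPosFunctional L S) (M : ℕ) :
    (p M).Splits := by
  refine (IsAlgClosed.splits _).of_splits_map (algebraMap ℝ ℂ) fun z hz => ?_
  have hz : aeval z (p M) = 0 := (mem_aroots.1 hz).2
  by_contra hzr
  have him : z.im ≠ 0 := fun h => hzr ⟨z.re, Complex.ext rfl (by simpa using h.symm)⟩
  refine hp.not_nonneg_dvd hL ?_ ?_ (quadratic_dvd_of_aeval_eq_zero_im_ne_zero _ hz him)
  · have : (X ^ 2 - C (2 * z.re) * X + C (‖z‖ ^ 2)).degree = 2 := by compute_degree!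
    rw [this]; norm_num
  · intro x _
    have := Complex.sq_norm z
    rw [Complex.normSq_apply] at this
    simp only [eval_add, eval_sub, eval_mul, eval_pow, eval_X, eval_C, this]
    nlinarith [sq_nonneg (x - z.re), sq_nonneg z.im]

theorem nodup_roots (hp : IsMonicOrthogonal L p) (hL : IsPosFunctional L S) (M : ℕ) :
    (p M).roots.Nodup := by
  rw [Multiset.nodup_iff_count_le_one]
  intro x
  by_contra! h
  rw [count_roots] at h
  have := (le_rootMultiplicity_iff (hp.monic M).ne_zero).1 h
  refine hp.not_nonneg_dvd hL ?_ ?_ this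
  · simp [degree_pow]
  · intro y _
    rw [eval_pow]
    exact sq_nonneg _

theorem roots_mem (hp : IsMonicOrthogonal L p) (hL : IsPosFunctional L S) (hS : S.OrdConnected)
    {M : ℕ} {x : ℝ} (hx : (p M).IsRoot x) : x ∈ S := by
  have hd := dvd_iff_isRoot.2 hx
  have hdeg : 0 < (X - C x).degree := by simp
  by_contra hxS
  by_cases h : ∀ y ∈ S, x ≤ y
  · exact hp.not_nonneg_dvd hL hdeg (fun y hy => by simpa using h y hy) hd
  · push Not at h
    obtain ⟨y, hy, hyx⟩ := h
    refine hp.not_nonneg_dvd hL (q := -(X - C x)) (by rwa [degree_neg]) (fun z hz => ?_)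
      (neg_dvd.2 hd)
    by_contra! hlt
    have : x < z := by simpa using hlt
    exact hxS (hS.out hy hz ⟨hyx.le, this.le⟩)

/-- `L` is positive on polynomials of degree below `2 * M` that are nonnegative, and not all
zero, at the zeros of `p M` (a consequence of Gauss quadrature). -/
theorem pos_of_nonneg_on_roots (hp : IsMonicOrthogonal L p) (hL : IsPosFunctional L S)
    {M : ℕ} {f : ℝ[X]} (hf : f.degree < (2 * M : ℕ))
    (hnonneg : ∀ x, (p M).IsRoot x → 0 ≤ f.eval x) (hpos : ∃ x, (p M).IsRoot x ∧ 0 < f.eval x) :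
    0 < L f := by
  classical
  set s := (p M).roots.toFinset with hs
  have hmem : ∀ x, x ∈ s ↔ (p M).IsRoot x := fun x => by
    simp [hs, (hp.monic M).ne_zero]
  have hinj : Set.InjOn id (s : Set ℝ) := Function.injective_id.injOn
  have hcard : s.card = M := by
    rw [hs, Multiset.toFinset_card_of_nodup (hp.nodup_roots hL M),
      ← (hp.splits hL M).natDegree_eq_card_roots, hp.natDegree]
  set ℓ : ℝ → ℝ[X] := Lagrange.basis s id
  have hℓ : ∀ x ∈ s, (ℓ x).natDegree = M - 1 := fun x hx => by
    rw [Lagrange.natDegree_basis hinj hx, hcard]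
  set r := f - ∑ x ∈ s, f.eval x • (ℓ x ^ 2) with hr
  have hdvd : p M ∣ r := by
    rw [(hp.splits hL M).eq_prod_roots_of_monic (hp.monic M)]
    have : (p M).roots = s.val := by
      rw [hs, Multiset.toFinset_val, (hp.nodup_roots hL M).dedup]
    rw [this]
    change ∏ x ∈ s, (X - C x) ∣ r
    refine Finset.prod_dvd_of_coprime (fun x _ y _ hxy => isCoprime_X_sub_C_of_isUnit_sub
      (sub_ne_zero.2 hxy).isUnit) fun y hy => ?_
    rw [dvd_iff_isRoot, IsRoot.def, hr, eval_sub, eval_finsetSum, Finset.sum_eq_single_of_mem y hy]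
    · have := Lagrange.eval_basis_self hinj hy
      simp only [id] at this
      simp [ℓ, this]
    · intro x _ hxy
      have := Lagrange.eval_basis_of_ne (v := id) hxy hy
      simp only [id] at this
      simp [ℓ, this]
  obtain ⟨Q, hQ⟩ := hdvd
  obtain ⟨y, hy, hfy⟩ := hpos
  have hM : 0 < M := by rw [← hcard]; exact Finset.card_pos.2 ⟨y, (hmem y).2 hy⟩
  have hrdeg : r.degree < (2 * M : ℕ) := by
    refine (degree_sub_le _ _).trans_lt (max_lt hf ?_)
    refine (degree_sum_le _ _).trans_lt ?_
    rw [Finset.sup_lt_iff (WithBot.bot_lt_coe _)]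
    intro x hx
    refine (degree_smul_le _ _).trans_lt (degree_le_natDegree.trans_lt ?_)
    rw [natDegree_pow, hℓ x hx]
    exact_mod_cast by omega
  have hQdeg : Q.degree < M := by
    rw [hQ, degree_mul, hp.degree] at hrdeg
    by_contra! h
    refine hrdeg.not_ge ?_
    calc ((2 * M : ℕ) : WithBot ℕ) = (M : WithBot ℕ) + M := by rw [two_mul]; rfl
      _ ≤ _ := by gcongr
  have hLr : L r = 0 := by rw [hQ]; exact hp.orth_of_degree_lt hQdeg
  have e : L f = ∑ x ∈ s, f.eval x * L (ℓ x ^ 2) := by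
    rw [hr, map_sub, map_sum, sub_eq_zero] at hLr
    rw [hLr]; simp
  have hℓpos : ∀ x ∈ s, 0 < L (ℓ x ^ 2) := fun x hx =>
    hL _ (pow_ne_zero _ (Lagrange.basis_ne_zero hinj hx)) fun _ _ => by
      rw [eval_pow]; positivity
  rw [e]
  exact Finset.sum_pos' (fun x hx => mul_nonneg (hnonneg x ((hmem x).1 hx)) (hℓpos x hx).le)
    ⟨y, (hmem y).2 hy, mul_pos hfy (hℓpos y ((hmem y).2 hy))⟩

/-- Solutions of a three-term recurrence are combinations of the two initial values whose
coefficients have exact degree. -/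
theorem _root_.Polynomial.exists_eq_of_recurrence {u q : ℕ → ℝ[X]} {γ : ℕ → ℝ} (i : ℕ)
    (hq : ∀ j ≤ i, (q j).degree = 1) (hγ : ∀ j ≤ i, γ j ≠ 0)
    (hu : ∀ j ≤ i, u (j + 2) = q j * u (j + 1) - C (γ j) * u j) :
    ∃ E D : ℝ[X], E.degree = (i + 1 : ℕ) ∧ D.degree = i ∧ u (i + 2) = E * u 1 - D * u 0 := by
  induction i generalizing u q γ with
  | zero =>
    exact ⟨q 0, C (γ 0), by simpa using hq 0 le_rfl, by simpa using degree_C (hγ 0 le_rfl),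
      hu 0 le_rfl⟩
  | succ i ih =>
    obtain ⟨E, D, hE, hD, h⟩ := ih (u := fun j => u (j + 1)) (q := fun j => q (j + 1))
      (γ := fun j => γ (j + 1)) (fun j hj => hq _ (by omega)) (fun j hj => hγ _ (by omega))
      (fun j hj => hu (j + 1) (by omega))
    have hEq : (E * q 0).degree = (i + 1 + 1 : ℕ) := by
      rw [degree_mul, hE, hq 0 (by omega)]; rfl
    refine ⟨E * q 0 - D, C (γ 0) * E, ?_, ?_, ?_⟩
    · rw [degree_sub_eq_left_of_degree_lt, hEq]
      rw [hD, hEq]; exact_mod_cast by omega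
    · rw [degree_C_mul (hγ 0 (by omega)), hE]
    · have := hu 0 (by omega)
      simp only [zero_add] at h this
      rw [show i + 1 + 2 = i + 2 + 1 from rfl, h, this]; ring

theorem exists_eq_forward (hp : IsMonicOrthogonal L p) (hL : IsPosFunctional L S) (l i : ℕ) :
    ∃ E D : ℝ[X], E.degree = (i + 1 : ℕ) ∧ D.degree = i ∧
      p (l + i + 2) = E * p (l + 1) - D * p l := by
  choose β hβ using hp.exists_recurrence hL
  exact exists_eq_of_recurrence (u := fun j => p (l + j)) i (fun j _ => degree_X_sub_C (β (l + j)))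
    (fun j _ => (div_pos (hp.norm_pos hL (l + j + 1)) (hp.norm_pos hL (l + j))).ne')
    fun j _ => hβ (l + j)

theorem exists_eq_backward (hp : IsMonicOrthogonal L p) (hL : IsPosFunctional L S) (l i : ℕ) :
    ∃ E D : ℝ[X], E.degree = (i + 1 : ℕ) ∧ D.degree = i ∧
      p l = E * p (l + i + 1) - D * p (l + i + 2) := by
  choose β hβ using hp.exists_recurrence hL
  set γ : ℕ → ℝ := fun j => L (p (j + 1) ^ 2) / L (p j ^ 2)
  have hγ : ∀ j, γ j ≠ 0 := fun j =>
    (div_pos (hp.norm_pos hL (j + 1)) (hp.norm_pos hL j)).ne'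
  obtain ⟨E, D, hE, hD, h⟩ := exists_eq_of_recurrence (u := fun j => p (l + i + 2 - j))
    (q := fun j => C (γ (l + i - j))⁻¹ * (X - C (β (l + i - j))))
    (γ := fun j => (γ (l + i - j))⁻¹) i
    (fun j _ => by rw [degree_C_mul (inv_ne_zero (hγ _)), degree_X_sub_C])
    (fun j _ => inv_ne_zero (hγ _)) (fun j hj => by
      have h := hβ (l + i - j)
      rw [show l + i + 2 - (j + 2) = l + i - j by omega,
        show l + i + 2 - (j + 1) = l + i - j + 1 by omega,
        show l + i + 2 - j = l + i - j + 2 by omega, h]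
      have hC : C (γ (l + i - j))⁻¹ * C (γ (l + i - j)) = 1 := by
        rw [← C_mul, inv_mul_cancel₀ (hγ _), C_1]
      linear_combination (-p (l + i - j)) * hC)
  refine ⟨E, D, hE, hD, ?_⟩
  simpa [show l + i + 2 - (i + 2) = l by omega] using h

/-- The polynomials `A * f - G * g` with `deg A < s` and `deg G < t`. -/
def _root_.Polynomial.combinations (f g : ℝ[X]) (s t : ℕ) : Submodule ℝ ℝ[X] where
  carrier := {F | ∃ A G : ℝ[X], A.degree < s ∧ G.degree < t ∧ F = A * f - G * g}
  zero_mem' := ⟨0, 0, by simp, by simp, by simp⟩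
  add_mem' := by
    rintro _ _ ⟨A, G, hA, hG, rfl⟩ ⟨A', G', hA', hG', rfl⟩
    exact ⟨A + A', G + G', (degree_add_le _ _).trans_lt (max_lt hA hA'),
      (degree_add_le _ _).trans_lt (max_lt hG hG'), by ring⟩
  smul_mem' := by
    rintro a _ ⟨A, G, hA, hG, rfl⟩
    exact ⟨a • A, a • G, (degree_smul_le _ _).trans_lt hA, (degree_smul_le _ _).trans_lt hG, by
      simp only [smul_eq_C_mul]; ring⟩

theorem mem_combinations (hp : IsMonicOrthogonal L p) (hL : IsPosFunctional L S) {N r s t j : ℕ}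
    (hj : N ≤ j) (hs : r + 1 ≤ s) (ht : r + 2 ≤ t) (hjs : j < N + r + 2 + s)
    (hjt : j < N + r + 3 + t) :
    p j ∈ combinations (p (N + r + 2)) (p (N + r + 1)) s t := by
  rcases lt_trichotomy j (N + r + 1) with h | rfl | h
  · obtain ⟨i, hi⟩ : ∃ i, N + r = j + i := ⟨N + r - j, by omega⟩
    obtain ⟨E, D, hE, hD, h⟩ := hp.exists_eq_backward hL j i
    refine ⟨-D, -E, ?_, ?_, ?_⟩
    · rw [degree_neg, hD]; exact_mod_cast by omega
    · rw [degree_neg, hE]; exact_mod_cast by omega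
    · rw [hi, h]; ring
  · exact ⟨0, -1, by simp, by rw [degree_neg, degree_one]; exact_mod_cast by omega, by ring⟩
  · obtain ⟨i, rfl⟩ : ∃ i, j = N + r + 1 + 1 + i := ⟨j - (N + r + 2), by omega⟩
    cases i with
    | zero => exact ⟨1, 0, by rw [degree_one]; exact_mod_cast by omega, by simp, by simp⟩
    | succ i =>
      obtain ⟨E, D, hE, hD, h⟩ := hp.exists_eq_forward hL (N + r + 1) i
      refine ⟨E, D, ?_, ?_, ?_⟩
      · rw [hE]; exact_mod_cast by omega
      · rw [hD]; exact_mod_cast by omega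
      · rw [← h]; congr 1; omega

theorem exists_eq_combination (hp : IsMonicOrthogonal L p) (hL : IsPosFunctional L S)
    {N r s t d : ℕ} {F : ℝ[X]} (hd : N ≤ d) (hF : F.degree < d)
    (horth : ∀ i < N, L (F * p i) = 0) (hs : r + 1 ≤ s) (ht : r + 2 ≤ t)
    (hds : d ≤ N + r + 2 + s) (hdt : d ≤ N + r + 3 + t) :
    ∃ A G : ℝ[X], A.degree < s ∧ G.degree < t ∧
      F = A * p (N + r + 2) - G * p (N + r + 1) :=
  hp.mem_of_forall_mem hL hd (W := combinations (p (N + r + 2)) (p (N + r + 1)) s t)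
    (fun _ h1 h2 => hp.mem_combinations hL h1 hs ht (by omega) (by omega)) hF horth

section Modification

variable {c : ℝ[X]} {g : ℕ → ℝ[X]}

theorem leadingCoeff_mul_norm_lt (hp : IsMonicOrthogonal L p) (hL : IsPosFunctional L S)
    (hS : S.OrdConnected) (hc : ∀ x ∈ S, 0 < c.eval x) {k N : ℕ} (hk : 1 ≤ k)
    (hcdeg : c.degree = (2 * k : ℕ)) {f : ℝ[X]} (hfm : f.Monic) (hf : f.natDegree = N) :
    c.leadingCoeff * L (p (N + k) ^ 2) < L (c * f ^ 2) := by
  have hc0 : c ≠ 0 := degree_ne_bot.1 (by rw [hcdeg]; exact WithBot.coe_ne_bot)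
  have hcd : c.natDegree = 2 * k := natDegree_eq_of_degree_eq_some hcdeg
  have key : 0 < L (c * f ^ 2 - C c.leadingCoeff * p (N + k) ^ 2) := by
    refine hp.pos_of_nonneg_on_roots hL (M := N + k) ?_ ?_ ?_
    · have h1 : (c * f ^ 2).degree = (2 * (N + k) : ℕ) := by
        rw [degree_eq_natDegree (mul_ne_zero hc0 (pow_ne_zero _ hfm.ne_zero)),
          natDegree_mul hc0 (pow_ne_zero _ hfm.ne_zero), natDegree_pow, hf, hcd]
        congr 1; omega
      rw [← h1]
      refine degree_sub_lt_left ?_ (mul_ne_zero hc0 (pow_ne_zero _ hfm.ne_zero)) ?_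
      · rw [h1, degree_C_mul (leadingCoeff_ne_zero.2 hc0), degree_pow, hp.degree]
        norm_cast
      · simp [hfm.leadingCoeff, (hp.monic _).leadingCoeff]
    · intro x hx
      simp only [eval_sub, eval_mul, eval_pow, hx.eq_zero]
      have := hc x (hp.roots_mem hL hS hx)
      simp only [ne_eq, OfNat.ofNat_ne_zero, not_false_eq_true, zero_pow, mul_zero, sub_zero]
      positivity
    · obtain ⟨x, hx, hfx⟩ : ∃ x, (p (N + k)).IsRoot x ∧ f.eval x ≠ 0 := by
        by_contra! h
        have hle : (p (N + k)).roots ≤ f.roots := by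
          rw [Multiset.le_iff_subset (hp.nodup_roots hL _)]
          intro x hx
          rw [mem_roots hfm.ne_zero]
          exact h x (isRoot_of_mem_roots hx)
        have h1 := Multiset.card_le_card hle
        rw [← (hp.splits hL _).natDegree_eq_card_roots, hp.natDegree] at h1
        have h2 := f.card_roots'
        omega
      refine ⟨x, hx, ?_⟩
      simp only [eval_sub, eval_mul, eval_pow, hx.eq_zero]
      have := hc x (hp.roots_mem hL hS hx)
      simp only [ne_eq, OfNat.ofNat_ne_zero, not_false_eq_true, zero_pow, mul_zero, sub_zero]
      positivity
  rw [← smul_eq_C_mul, map_sub, map_smul, smul_eq_mul] at key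
  linarith

theorem apply_modification_mul_of_lt (hp : IsMonicOrthogonal L p)
    (hg : IsMonicOrthogonal (L ∘ₗ LinearMap.mulLeft ℝ c) g) {i N : ℕ} (hi : i < N) :
    L (c * g N * p i) = 0 := by
  have := hg.orth_of_degree_lt (j := N) (u := p i) (by rw [hp.degree]; exact_mod_cast hi)
  simpa [mul_assoc] using this

theorem apply_modification_mul_self (hp : IsMonicOrthogonal L p)
    (hg : IsMonicOrthogonal (L ∘ₗ LinearMap.mulLeft ℝ c) g) (N : ℕ) :
    L (c * g N * p N) = L (c * g N ^ 2) := by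
  have := hg.apply_mul_of_degree_lt (j := N) (u := p N)
    (by rw [hp.degree]; exact_mod_cast N.lt_succ_self)
  rw [hp.coeff_self, one_mul] at this
  simpa [mul_assoc] using this

theorem _root_.Polynomial.degree_le_of_lt_succ {B : ℝ[X]} {s : ℕ} (hB : B.degree < (s + 1 : ℕ)) :
    B.degree ≤ s := by
  rw [degree_le_iff_coeff_zero]
  exact fun i hi => (degree_lt_iff_coeff_zero _ _).1 hB i (by exact_mod_cast hi)

theorem coeff_mul_of_degree_lt (hp : IsMonicOrthogonal L p) {B : ℝ[X]} {s : ℕ}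
    (hB : B.degree < (s + 1 : ℕ)) (l : ℕ) : (B * p l).coeff (s + l) = B.coeff s := by
  rw [coeff_mul_add_eq_of_natDegree_le
    (natDegree_le_of_degree_le (degree_le_of_lt_succ hB)) (hp.natDegree l).le,
    hp.coeff_self, mul_one]

/-- Pairing a connection formula with `p N` relates the top coefficients of `A` and `G`. -/
theorem coeff_relation (hp : IsMonicOrthogonal L p) {N r : ℕ} {A G : ℝ[X]}
    (hA : A.degree < (r + 3 : ℕ)) (hG : G.degree < (r + 2 : ℕ)) :
    L ((A * p (N + r + 2) - G * p (N + r + 1)) * p N) =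
      A.coeff (r + 2) * L (p (N + r + 2) ^ 2) - G.coeff (r + 1) * L (p (N + r + 1) ^ 2) := by
  have aux : ∀ {B : ℝ[X]} {s : ℕ}, B.degree < (s + 1 : ℕ) →
      L (p (N + s) * (B * p N)) = B.coeff s * L (p (N + s) ^ 2) := by
    intro B s hB
    have hdeg : (B * p N).degree < (N + s + 1 : ℕ) := by
      rw [degree_mul, hp.degree, show N + s + 1 = s + 1 + N by omega, Nat.cast_add]
      exact WithBot.add_lt_add_right WithBot.coe_ne_bot hB
    rw [hp.apply_mul_of_degree_lt hdeg, add_comm N s, hp.coeff_mul_of_degree_lt hB]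
  have e : (A * p (N + r + 2) - G * p (N + r + 1)) * p N =
      p (N + (r + 2)) * (A * p N) - p (N + (r + 1)) * (G * p N) := by
    simp only [← add_assoc]; ring
  rw [e, map_sub, aux hA, aux hG]
  rfl

theorem exists_connection (hp : IsMonicOrthogonal L p) (hL : IsPosFunctional L S)
    (hS : S.OrdConnected) (hc : ∀ x ∈ S, 0 < c.eval x) {k : ℕ} (hcdeg : c.degree = (2 * k : ℕ))
    (hg : IsMonicOrthogonal (L ∘ₗ LinearMap.mulLeft ℝ c) g) (N r : ℕ) :
    ∃ A G : ℝ[X], c * g N = A * p (N + r + 2) - G * p (N + r + 1) ∧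
      G.degree = (max (r + 1) (2 * k - r - 3) : ℕ) ∧
      A.degree = (if k ≤ r + 1 then r else 2 * k - r - 2 : ℕ) := by
  have hc0 : c ≠ 0 := degree_ne_bot.1 (by rw [hcdeg]; exact WithBot.coe_ne_bot)
  have hlc := leadingCoeff_ne_zero.2 hc0
  set lc := c.leadingCoeff
  have hFdeg : (c * g N).natDegree = N + 2 * k := by
    rw [natDegree_mul hc0 (hg.monic N).ne_zero, hg.natDegree,
      natDegree_eq_of_degree_eq_some hcdeg, add_comm]
  have hFlc : (c * g N).coeff (N + 2 * k) = lc := by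
    rw [← hFdeg, coeff_natDegree, leadingCoeff_mul, (hg.monic N).leadingCoeff, mul_one]
  have hFlt : (c * g N).degree < (N + 2 * k + 1 : ℕ) :=
    (degree_le_of_natDegree_le hFdeg.le).trans_lt (by exact_mod_cast by omega)
  have horth : ∀ i < N, L (c * g N * p i) = 0 := fun i hi => hp.apply_modification_mul_of_lt hg hi
  have hΛ := hp.apply_modification_mul_self hg N
  have hΛpos : 0 < L (c * g N ^ 2) :=
    hL _ (mul_ne_zero hc0 (pow_ne_zero _ (hg.monic N).ne_zero)) fun x hx => by
      rw [eval_mul, eval_pow]; exact mul_nonneg (hc x hx).le (sq_nonneg _)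
  rcases Nat.lt_or_ge k (r + 2) with hk | hk
  · obtain ⟨A, G, hA, hG, hF⟩ := hp.exists_eq_combination hL (r := r) (s := r + 1) (t := r + 2)
      (by omega) hFlt horth le_rfl le_rfl (by omega) (by omega)
    have hrel := hp.coeff_relation (N := N) (hA.trans (by exact_mod_cast by omega)) hG
    rw [← hF, hΛ, coeff_eq_zero_of_degree_lt (hA.trans (by exact_mod_cast by omega)),
      zero_mul, zero_sub] at hrel
    have hGne : G.coeff (r + 1) ≠ 0 := by
      intro h; rw [h] at hrel; linarith
    have hAne : A.coeff r ≠ 0 := by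
      have h1 : (c * g N).coeff (N + 2 * (r + 1)) = A.coeff r - G.coeff (r + 1) := by
        rw [hF, coeff_sub, ← hp.coeff_mul_of_degree_lt hA (N + r + 2),
          ← hp.coeff_mul_of_degree_lt hG (N + r + 1)]
        congr 2 <;> omega
      intro h
      rw [h, zero_sub] at h1
      rw [neg_mul_eq_neg_mul, ← h1] at hrel
      rcases Nat.lt_or_ge k (r + 1) with hk' | hk'
      · rw [coeff_eq_zero_of_natDegree_lt (by omega), zero_mul] at hrel
        exact hΛpos.ne' hrel
      · obtain rfl : k = r + 1 := by omega
        have := hp.leadingCoeff_mul_norm_lt hL hS hc (by omega) hcdeg (hg.monic N) (hg.natDegree N)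
        rw [hFlc] at hrel
        exact this.ne' hrel
    refine ⟨A, G, hF, ?_, ?_⟩
    · rw [max_eq_left (by omega)]
      exact degree_eq_of_le_of_coeff_ne_zero (degree_le_of_lt_succ hG) hGne
    · rw [if_pos (by omega)]
      exact degree_eq_of_le_of_coeff_ne_zero (degree_le_of_lt_succ hA) hAne
  · obtain ⟨i, hi⟩ : ∃ i, k = r + 2 + i := ⟨k - (r + 2), by omega⟩
    have hN2k : N + r + 1 + (r + 1 + 2 * i) + 2 = N + 2 * k := by omega
    obtain ⟨E, D, hE, hD, hED⟩ := hp.exists_eq_forward hL (N + r + 1) (r + 1 + 2 * i)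
    rw [hN2k] at hED
    obtain ⟨A, G, hA, hG, hF⟩ := hp.exists_eq_combination hL (N := N) (r := r)
      (s := r + 2 + 2 * i) (t := max (r + 2) (r + 1 + 2 * i)) (d := N + 2 * k) (by omega)
      (hp.degree_sub_lt hFlt) (fun j hj => by
        have e : (c * g N - C ((c * g N).coeff (N + 2 * k)) * p (N + 2 * k)) * p j =
            c * g N * p j - (c * g N).coeff (N + 2 * k) • (p (N + 2 * k) * p j) := by
          rw [smul_eq_C_mul]; ring
        rw [e, map_sub, map_smul, horth j hj, hp.orth _ j (by omega)]
        simp) (by omega) (le_max_left _ _) (by omega) (by omega)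
    rw [hFlc, sub_eq_iff_eq_add, hED] at hF
    have hF : c * g N = (A + C lc * E) * p (N + r + 2) - (G + C lc * D) * p (N + r + 1) := by
      rw [hF]; ring
    have hE' : (C lc * E).degree = (r + 2 + 2 * i : ℕ) := by
      rw [degree_C_mul hlc, hE]; congr 1; omega
    have hD' : (C lc * D).degree = (r + 1 + 2 * i : ℕ) := by rw [degree_C_mul hlc, hD]
    have hAdeg : (A + C lc * E).degree = (r + 2 + 2 * i : ℕ) := by
      rw [degree_add_eq_right_of_degree_lt (by rwa [hE']), hE']
    refine ⟨_, _, hF, ?_, ?_⟩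
    · rw [show max (r + 1) (2 * k - r - 3) = r + 1 + 2 * i by omega]
      rcases Nat.eq_zero_or_pos i with rfl | hipos
      · have hAlt : (A + C lc * E).degree < (r + 3 : ℕ) := by
          rw [hAdeg]; exact_mod_cast by omega
        have hGlt : (G + C lc * D).degree < (r + 2 : ℕ) := by
          refine (degree_add_le _ _).trans_lt (max_lt (hG.trans_eq ?_) ?_)
          · congr 1; omega
          · rw [hD']; exact_mod_cast by omega
        have hrel := hp.coeff_relation (N := N) hAlt hGlt
        have hAc := hp.coeff_mul_of_degree_lt hAlt (N + r + 2)
        have hGz : ((G + C lc * D) * p (N + r + 1)).coeff (r + 2 + (N + r + 2)) = 0 := by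
          refine coeff_eq_zero_of_degree_lt ?_
          rw [degree_mul, hp.degree, show r + 2 + (N + r + 2) = r + 3 + (N + r + 1) by omega,
            Nat.cast_add (r + 3)]
          exact WithBot.add_lt_add_right WithBot.coe_ne_bot
            (hGlt.trans (by exact_mod_cast by omega))
        have hlcA : (A + C lc * E).coeff (r + 2) = lc := by
          have h := hFlc
          rwa [hF, coeff_sub, show N + 2 * k = r + 2 + (N + r + 2) by omega, hGz, sub_zero,
            hAc] at h
        rw [← hF, hΛ, hlcA] at hrel
        have hlt := hp.leadingCoeff_mul_norm_lt hL hS hc (by omega) hcdeg (hg.monic N)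
          (hg.natDegree N)
        rw [show N + k = N + r + 2 by omega] at hlt
        refine degree_eq_of_le_of_coeff_ne_zero (degree_le_of_lt_succ hGlt) fun h => ?_
        simp only [mul_zero, add_zero] at h
        rw [h] at hrel
        linarith
      · rw [degree_add_eq_right_of_degree_lt, hD']
        rw [hD']
        refine hG.trans_eq ?_
        congr 1; omega
    · rw [if_neg (by omega), hAdeg]
      congr 1; omega

end Modification

end IsMonicOrthogonal

section Integral

variable {S : Set ℝ} {w : ℝ → ℝ}

theorem integrableOn_eval_mul (hmom : ∀ j : ℕ, IntegrableOn (fun x => x ^ j * w x) S)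
    (f : ℝ[X]) : IntegrableOn (fun x => f.eval x * w x) S := by
  simp only [eval_eq_sum_range, Finset.sum_mul, mul_assoc]
  exact integrable_finsetSum _ fun i _ => (hmom i).const_mul _

/-- Integration of polynomials against the weight `w` on `S`. -/
noncomputable def integralFunctional (hmom : ∀ j : ℕ, IntegrableOn (fun x => x ^ j * w x) S) :
    ℝ[X] →ₗ[ℝ] ℝ where
  toFun f := ∫ x in S, f.eval x * w x
  map_add' f g := by
    simp only [eval_add, add_mul]
    exact integral_add (integrableOn_eval_mul hmom f) (integrableOn_eval_mul hmom g)
  map_smul' a f := by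
    simp only [eval_smul, smul_eq_mul, mul_assoc, RingHom.id_apply]
    exact integral_const_mul _ _

theorem isPosFunctional_integralFunctional
    (hmom : ∀ j : ℕ, IntegrableOn (fun x => x ^ j * w x) S) (hS : IsOpen S) (hne : S.Nonempty)
    (hw : ∀ x ∈ S, 0 < w x) : IsPosFunctional (integralFunctional hmom) S := by
  intro f hf0 hf
  change 0 < ∫ x in S, f.eval x * w x
  rw [setIntegral_pos_iff_support_of_nonneg_ae
    (ae_restrict_of_forall_mem hS.measurableSet fun x hx => mul_nonneg (hf x hx) (hw x hx).le)
    (integrableOn_eval_mul hmom f)]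
  calc 0 < volume S := hS.measure_pos volume hne
    _ = volume (S \ (f.roots.toFinset : Set ℝ)) :=
      (measure_sdiff_null (Finset.measure_zero _ _)).symm
    _ ≤ volume (Function.support (fun x => f.eval x * w x) ∩ S) := measure_mono fun x hx =>
      ⟨mul_ne_zero (fun h => hx.2 (by simp [hf0, h])) (hw x hx.1).ne', hx.1⟩

end Integral

/-- **Theorem 2.1 (connection formula for a modification by an even factor).**
Let `k ∈ ℕ₀` and `m ∈ {2,…,n}`, let `{p_j}` be a sequence of monic real polynomials
with `deg p_j = j`, orthogonal on the (possibly infinite) interval `(a,b)` with respect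
to a weight `w > 0` with finite moments, let `c` be an even polynomial of exact degree
`2k` with `c·w > 0` on `(a,b)`, and let `{g_j}` be monic polynomials with `deg g_j = j`,
orthogonal with respect to `c·w`. Then `c·g_{n-m} = a_{2k-m}·p_n − G·p_{n-1}` with
`deg G = max{m−1, 2k−m−1}`, `deg a_{2k-m} = m−2` if `k ≤ m−1` and `= 2k−m` if `k ≥ m`;
in particular `deg G = m−1` iff `k ∈ {0,…,m}`. -/
theorem connection_formula_even_modification
    (a b : EReal) (hab : a < b)
    (S : Set ℝ) (hS : S = {x : ℝ | a < (x : EReal) ∧ (x : EReal) < b})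
    (w : ℝ → ℝ) (hw : ∀ x ∈ S, 0 < w x)
    (hmom : ∀ j : ℕ, IntegrableOn (fun x => x ^ j * w x) S)
    (p : ℕ → Polynomial ℝ)
    (hpmonic : ∀ j, (p j).Monic) (hpdeg : ∀ j, (p j).natDegree = j)
    (hporth : ∀ i j, i ≠ j → ∫ x in S, (p i).eval x * (p j).eval x * w x = 0)
    (k n m : ℕ) (hm2 : 2 ≤ m) (hmn : m ≤ n)
    (c : Polynomial ℝ) (hceven : ∀ x : ℝ, c.eval (-x) = c.eval x)
    (hcdeg : c.degree = ((2 * k : ℕ) : WithBot ℕ))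
    (hcw : ∀ x ∈ S, 0 < c.eval x * w x)
    (hcwmom : ∀ j : ℕ, IntegrableOn (fun x => x ^ j * (c.eval x * w x)) S)
    (g : ℕ → Polynomial ℝ)
    (hgmonic : ∀ j, (g j).Monic) (hgdeg : ∀ j, (g j).natDegree = j)
    (hgorth : ∀ i j, i ≠ j →
      ∫ x in S, (g i).eval x * (g j).eval x * (c.eval x * w x) = 0) :
    ∃ A G : Polynomial ℝ,
      c * g (n - m) = A * p n - G * p (n - 1) ∧
      G.degree = ((max (m - 1) (2 * k - m - 1) : ℕ) : WithBot ℕ) ∧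
      (k ≤ m - 1 → A.degree = ((m - 2 : ℕ) : WithBot ℕ)) ∧
      (m ≤ k → A.degree = ((2 * k - m : ℕ) : WithBot ℕ)) ∧
      (G.degree = ((m - 1 : ℕ) : WithBot ℕ) ↔ k ≤ m) := by
  have hSpre : S = (fun x : ℝ => (x : EReal)) ⁻¹' Set.Ioo a b := hS
  have hopen : IsOpen S := hSpre ▸ isOpen_Ioo.preimage continuous_coe_real_ereal
  have hconn : S.OrdConnected :=
    hSpre ▸ Set.ordConnected_Ioo.preimage_mono fun _ _ h => EReal.coe_le_coe_iff.2 h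
  have hne : S.Nonempty := by
    obtain ⟨x, hx⟩ := EReal.lt_iff_exists_real_btwn.1 hab
    exact ⟨x, by rwa [hS]⟩
  have hp : IsMonicOrthogonal (integralFunctional hmom) p :=
    ⟨hpmonic, hpdeg, fun i j hij => by
      simpa only [integralFunctional, LinearMap.coe_mk, AddHom.coe_mk, eval_mul]
        using hporth i j hij⟩
  have hg : IsMonicOrthogonal (integralFunctional hmom ∘ₗ LinearMap.mulLeft ℝ c) g :=
    ⟨hgmonic, hgdeg, fun i j hij => by
      rw [← hgorth i j hij]
      change ∫ x in S, (c * (g i * g j)).eval x * w x = _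
      congr 1 with x
      rw [eval_mul, eval_mul]
      ring⟩
  obtain ⟨r, rfl⟩ : ∃ r, m = r + 2 := ⟨m - 2, by omega⟩
  obtain ⟨N, rfl⟩ : ∃ N, n = N + r + 2 := ⟨n - (r + 2), by omega⟩
  obtain ⟨A, G, hF, hG, hA⟩ := hp.exists_connection
    (isPosFunctional_integralFunctional hmom hopen hne hw) hconn
    (fun x hx => pos_of_mul_pos_left (hcw x hx) (hw x hx).le) hcdeg hg N r
  refine ⟨A, G, ?_, ?_, fun h => ?_, fun h => ?_, ?_⟩
  · rwa [show N + r + 2 - (r + 2) = N by omega]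
  · rw [hG, Nat.cast_inj]; omega
  · rw [hA, if_pos (by omega)]; rfl
  · rw [hA, if_neg (by omega), Nat.cast_inj]; omega
  · rw [hG, Nat.cast_inj]; omega
end

section
/- Let {p_j} be a sequence of monic real polynomials with deg p_j = j, orthogonal on (a,b) with respect to the weight w(x) > 0, let k ∈ ℕ₀ be fixed, let c_{2k} be a real polynomial of degree 2k with c_{2k}(x)w(x) > 0 on (a,b), and let {g_{j,k}} be a sequence of monic real polynomials with deg g_{j,k} = j, orthogonal on (a,b) with respect to c_{2k}(x)w(x). Suppose that for every n ∈ {2,3,…} there are real constants A_n, B_n and a real polynomial a_{2k−2} defined on (a,b), of degree 2k−2 when k ∈ {1,2,…} and constant when k = 0, such that A_n·c_{2k}(x)·g_{n−2,k}(x) = a_{2k−2}(x)·p_n(x) − (x − B_n)·p_{n−1}(x) for all x ∈ (a,b). Then k ∈ {0,1,2}. -/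
open MeasureTheory Polynomial

/-- If all moments of `w` on `S` are finite, then polynomials are integrable against `w`. -/
lemma integrableOn_eval_mul_of_moments {S : Set ℝ} {w : ℝ → ℝ}
    (hmom : ∀ j : ℕ, IntegrableOn (fun x => x ^ j * w x) S) (r : Polynomial ℝ) :
    IntegrableOn (fun x => r.eval x * w x) S := by
  induction r using Polynomial.induction_on' with
  | add p q hp hq =>
    simp only [eval_add, add_mul]
    exact hp.add hq
  | monomial n t =>
    simp only [eval_monomial, mul_assoc]
    exact (hmom n).const_mul t

/-- Integration of polynomials against a weight with finite moments, as a linear functional. -/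
noncomputable def momentFunctional (S : Set ℝ) (w : ℝ → ℝ)
    (hmom : ∀ j : ℕ, IntegrableOn (fun x => x ^ j * w x) S) : Polynomial ℝ →ₗ[ℝ] ℝ where
  toFun r := ∫ x in S, r.eval x * w x
  map_add' r s := by
    simp only [eval_add, add_mul]
    exact integral_add (integrableOn_eval_mul_of_moments hmom r)
      (integrableOn_eval_mul_of_moments hmom s)
  map_smul' t r := by
    simp only [eval_smul, smul_eq_mul, mul_assoc, RingHom.id_apply]
    exact integral_const_mul _ _

/-- A polynomial of degree less than `m` is a linear combination of the first `m` members of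
a monic sequence, so `L (· * f)` vanishes on it as soon as it vanishes on those members. -/
lemma map_mul_eq_zero_of_degree_lt (L : Polynomial ℝ →ₗ[ℝ] ℝ) {p : ℕ → Polynomial ℝ}
    (hpmonic : ∀ j, (p j).Monic) (hpdeg : ∀ j, (p j).natDegree = j) (f : Polynomial ℝ) (m : ℕ)
    (hf : ∀ i < m, L (p i * f) = 0) (r : Polynomial ℝ) (hr : r.degree < m) : L (r * f) = 0 := by
  induction m generalizing r with
  | zero =>
    have : r = 0 := by simpa using hr
    simp [this]
  | succ m ih =>
    have hdeg : (r - r.coeff m • p m).degree < m := by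
      rw [degree_lt_iff_coeff_zero] at hr ⊢
      intro i hi
      rcases hi.eq_or_lt with rfl | hi
      · have : (p m).coeff m = 1 := by simpa [hpdeg m] using (hpmonic m).coeff_natDegree
        simp [this]
      · have : (p m).coeff i = 0 := coeff_eq_zero_of_natDegree_lt (by rwa [hpdeg])
        simp [this, hr i hi]
    have h := ih (fun i hi => hf i (hi.trans m.lt_succ_self)) _ hdeg
    simpa [sub_mul, hf m m.lt_succ_self] using h

/-- A nonzero polynomial has positive square norm for a positive weight on a nonempty open set. -/
lemma momentFunctional_mul_self_pos {S : Set ℝ} (hopen : IsOpen S) (hne : S.Nonempty)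
    {w : ℝ → ℝ} (hw : ∀ x ∈ S, 0 < w x)
    (hmom : ∀ j : ℕ, IntegrableOn (fun x => x ^ j * w x) S) {r : Polynomial ℝ} (hr : r ≠ 0) :
    0 < momentFunctional S w hmom (r * r) := by
  have hnonneg : ∀ x ∈ S, 0 ≤ (r * r).eval x * w x := fun x hx => by
    rw [eval_mul]
    exact mul_nonneg (mul_self_nonneg _) (hw x hx).le
  refine (setIntegral_pos_iff_support_of_nonneg_ae
    ((ae_restrict_iff' hopen.measurableSet).2 (ae_of_all _ hnonneg))
    (integrableOn_eval_mul_of_moments hmom _)).2 ?_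
  have hroots : volume {x | r.IsRoot x} = 0 := (finite_setOfPred_isRoot hr).measure_zero _
  calc 0 < volume S := hopen.measure_pos _ hne
    _ = volume (S \ {x | r.IsRoot x}) := (measure_sdiff_null hroots).symm
    _ ≤ _ := measure_mono fun x hx => by
      have hx0 : r.eval x ≠ 0 := hx.2
      exact ⟨by simp [hx0, (hw x hx.1).ne'], hx.1⟩

/-- **Corollary 2.2 (i).** If `{p_j}` is monic orthogonal w.r.t. `w > 0` on `(a,b)`,
`c` is a polynomial of degree `2k` with `c·w > 0` on `(a,b)`, `{g_j}` is monic
orthogonal w.r.t. `c·w`, and for every `n ≥ 2` there are constants `A_n, B_n` and a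
polynomial `a_{2k−2}` (of degree `2k−2` when `k ≥ 1`, constant when `k = 0`) with
`A_n·c(x)·g_{n−2}(x) = a_{2k−2}(x)·p_n(x) − (x − B_n)·p_{n−1}(x)` on `(a,b)`,
then `k ∈ {0,1,2}`. -/
theorem even_modification_linear_coefficient_k_le_two
    (a b : EReal) (hab : a < b)
    (S : Set ℝ) (hS : S = {x : ℝ | a < (x : EReal) ∧ (x : EReal) < b})
    (w : ℝ → ℝ) (hw : ∀ x ∈ S, 0 < w x)
    (hmom : ∀ j : ℕ, IntegrableOn (fun x => x ^ j * w x) S)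
    (p : ℕ → Polynomial ℝ)
    (hpmonic : ∀ j, (p j).Monic) (hpdeg : ∀ j, (p j).natDegree = j)
    (hporth : ∀ i j, i ≠ j → ∫ x in S, (p i).eval x * (p j).eval x * w x = 0)
    (k : ℕ)
    (c : Polynomial ℝ) (hcdeg : c.degree = ((2 * k : ℕ) : WithBot ℕ))
    (hcw : ∀ x ∈ S, 0 < c.eval x * w x)
    (hcwmom : ∀ j : ℕ, IntegrableOn (fun x => x ^ j * (c.eval x * w x)) S)
    (g : ℕ → Polynomial ℝ)
    (hgmonic : ∀ j, (g j).Monic) (hgdeg : ∀ j, (g j).natDegree = j)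
    (hgorth : ∀ i j, i ≠ j →
      ∫ x in S, (g i).eval x * (g j).eval x * (c.eval x * w x) = 0)
    (hrec : ∀ n : ℕ, 2 ≤ n → ∃ (A B : ℝ) (q : Polynomial ℝ),
      (k = 0 → q.natDegree = 0) ∧
      (1 ≤ k → q.degree = ((2 * k - 2 : ℕ) : WithBot ℕ)) ∧
      ∀ x ∈ S, A * c.eval x * (g (n - 2)).eval x =
        q.eval x * (p n).eval x - (x - B) * (p (n - 1)).eval x) :
    k ≤ 2 := by
  by_contra! hk
  have hopen : IsOpen S := by
    rw [hS]
    exact (isOpen_lt continuous_const continuous_coe_real_ereal).inter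
      (isOpen_lt continuous_coe_real_ereal continuous_const)
  have hne : S.Nonempty := by
    obtain ⟨x, hx⟩ := EReal.lt_iff_exists_real_btwn.1 hab
    exact ⟨x, hS ▸ hx⟩
  set L := momentFunctional S w hmom
  have hLapply (r : Polynomial ℝ) : L r = ∫ x in S, r.eval x * w x := rfl
  have horth (i j : ℕ) (hij : i ≠ j) : L (p i * p j) = 0 := by
    simpa [hLapply] using hporth i j hij
  have hlow (n : ℕ) (r : Polynomial ℝ) (hr : r.degree < n) : L (r * p n) = 0 :=
    map_mul_eq_zero_of_degree_lt L hpmonic hpdeg (p n) n (fun i hi => horth i n hi.ne) r hr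
  obtain ⟨n, hn⟩ : ∃ n, n = 2 * k - 2 := ⟨_, rfl⟩
  obtain ⟨A, B, q, -, hqdeg, hq⟩ := hrec n (by omega)
  replace hqdeg : q.degree = n := hn ▸ hqdeg (by omega)
  have hq0 : q ≠ 0 := by
    rintro rfl
    simp at hqdeg
  have hint : L (q * p n) - L ((X - C B) * p (n - 1)) = 0 := by
    rw [← map_sub, hLapply]
    have hg0 : g 0 = 1 := (hgmonic 0).natDegree_eq_zero.1 (hgdeg 0)
    calc ∫ x in S, (q * p n - (X - C B) * p (n - 1)).eval x * w x
        = ∫ x in S, A * ((g (n - 2)).eval x * (g 0).eval x * (c.eval x * w x)) :=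
          setIntegral_congr_fun hopen.measurableSet fun x hx => by
            simp only [eval_sub, eval_mul, eval_X, eval_C, ← hq x hx, hg0, eval_one]
            ring
      _ = 0 := by rw [integral_const_mul, hgorth _ _ (by omega), mul_zero]
  rw [hlow (n - 1) (X - C B) (by
    rw [degree_X_sub_C]
    exact_mod_cast (by omega : 1 < n - 1)), sub_zero] at hint
  have hpn : (p n).degree = n := by rw [degree_eq_natDegree (hpmonic n).ne_zero, hpdeg]
  have hlead : q.leadingCoeff ≠ 0 := leadingCoeff_ne_zero.2 hq0
  have hrem : (q - q.leadingCoeff • p n).degree < n := by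
    rw [← hqdeg]
    refine degree_sub_lt_left ?_ hq0 ?_
    · rw [degree_smul_of_smul_regular _ (IsSMulRegular.of_ne_zero hlead), hqdeg, hpn]
    · rw [smul_eq_C_mul, leadingCoeff_mul, leadingCoeff_C, (hpmonic n).leadingCoeff, mul_one]
  have hzero := hlow n _ hrem
  rw [sub_mul, map_sub, hint, smul_mul_assoc, map_smul, zero_sub, neg_eq_zero, smul_eq_mul] at hzero
  exact (mul_ne_zero hlead
    (momentFunctional_mul_self_pos hopen hne hw hmom (hpmonic n).ne_zero).ne') hzero
end

section
/- For every λ > 0, every φ with 0 < φ < π, every integer n ≥ 2 and every x ∈ ℂ, the monic Meixner–Pollaczek polynomials satisfy the mixed three-term recurrence [(n−1)(λ² + x²)/(2λ + n − 1)] · P_{n−2}^{(λ+1)}(x;φ) = (x + λ·cos φ/sin φ) · P_{n−1}^{(λ)}(x;φ) − [2λ/(2λ + n − 1)] · P_n^{(λ)}(x;φ). -/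
open scoped BigOperators

/-- Pochhammer symbol `(α)_j = α(α+1)⋯(α+j−1)` in a commutative semiring. -/
noncomputable def poch {R : Type*} [CommSemiring R] (α : R) (j : ℕ) : R :=
  ∏ i ∈ Finset.range j, (α + i)

/-- The monic Meixner–Pollaczek polynomial
`P_n^{(λ)}(x;φ) = iⁿ (2λ)_n (e^{2iφ}/(e^{2iφ}−1))ⁿ ·
  Σ_{j=0}^{n} [(−n)_j (λ+ix)_j / ((2λ)_j · j!)] (1 − e^{−2iφ})^j`. -/
noncomputable def meixnerPollaczek (lam phi : ℝ) (n : ℕ) (x : ℂ) : ℂ :=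
  Complex.I ^ n * poch (2 * (lam : ℂ)) n *
    (Complex.exp (2 * Complex.I * phi) / (Complex.exp (2 * Complex.I * phi) - 1)) ^ n *
    ∑ j ∈ Finset.range (n + 1),
      poch (-(n : ℂ)) j * poch ((lam : ℂ) + Complex.I * x) j /
          (poch (2 * (lam : ℂ)) j * (j.factorial : ℂ)) *
        (1 - Complex.exp (-(2 * Complex.I * phi))) ^ j

lemma poch_zero {R : Type*} [CommSemiring R] (α : R) : poch α 0 = 1 := by
  simp [poch]

lemma poch_succ {R : Type*} [CommSemiring R] (α : R) (j : ℕ) :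
    poch α (j + 1) = poch α j * (α + j) := by
  simp [poch, Finset.prod_range_succ]

lemma poch_succ_left {R : Type*} [CommSemiring R] (α : R) (j : ℕ) :
    poch α (j + 1) = α * poch (α + 1) j := by
  simp only [poch, Finset.prod_range_succ', Nat.cast_zero, add_zero, Nat.cast_succ]
  rw [mul_comm]
  congr 1
  exact Finset.prod_congr rfl fun i _ => by ring

lemma poch_ne_zero {α : ℂ} (h : ∀ k : ℕ, α + k ≠ 0) (j : ℕ) : poch α j ≠ 0 :=
  Finset.prod_ne_zero_iff.2 fun i _ => h i

lemma poch_neg_nat_succ (n : ℕ) : poch (-(n : ℂ)) (n + 1) = 0 := by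
  simp [poch_succ]

/-- The `j`-th term of the hypergeometric series `₂F₁(α, β; γ; z)`. -/
noncomputable def hypergeomTerm (α β γ z : ℂ) (j : ℕ) : ℂ :=
  poch α j * poch β j / (poch γ j * (j.factorial : ℂ)) * z ^ j

lemma hypergeomTerm_mixed (b a c z : ℂ) (hc : ∀ k : ℕ, c + k ≠ 0) (j : ℕ) :
    c * hypergeomTerm (b + 1) a c z (j + 2) - a * z * hypergeomTerm (b + 1) a c z (j + 1) -
        c * hypergeomTerm b a c z (j + 2) =
      (b + 1) * a * (c - a) * z ^ 2 / (c * (c + 1)) *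
        hypergeomTerm (b + 2) (a + 1) (c + 2) z j := by
  have hc0 : c ≠ 0 := by simpa using hc 0
  have hc1 : c + 1 ≠ 0 := by simpa using hc 1
  have hc2 : ∀ k : ℕ, c + 2 + k ≠ 0 := fun k => by
    have := hc (k + 2)
    push_cast at this
    rwa [add_assoc, add_comm (2 : ℂ)]
  have hcj : c + 1 + j ≠ 0 := by
    have := hc (j + 1)
    push_cast at this
    rwa [add_assoc, add_comm (1 : ℂ)]
  have hP := poch_ne_zero hc2 j
  have hf : (j.factorial : ℂ) ≠ 0 := Nat.cast_ne_zero.2 j.factorial_ne_zero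
  have hj1 : (j : ℂ) + 1 ≠ 0 := Nat.cast_add_one_ne_zero j
  have hj2 : (j : ℂ) + 1 + 1 ≠ 0 := by exact_mod_cast (Nat.succ_ne_zero (j + 1))
  have e1 : poch (b + 1) (j + 2) = (b + 1) * (poch (b + 2) j * (b + 2 + j)) := by
    rw [poch_succ_left, poch_succ]; ring_nf
  have e2 : poch (b + 1) (j + 1) = (b + 1) * poch (b + 2) j := by
    rw [poch_succ_left]; ring_nf
  have e3 : poch b (j + 2) = b * ((b + 1) * poch (b + 2) j) := by
    rw [poch_succ_left, e2]
  have e4 : poch a (j + 2) = a * (poch (a + 1) j * (a + 1 + j)) := by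
    rw [poch_succ_left, poch_succ]
  have e5 : poch c (j + 2) = c * ((c + 1) * poch (c + 2) j) := by
    rw [poch_succ_left, poch_succ_left]; ring_nf
  have e6 : poch c (j + 1) = c * ((c + 1) * poch (c + 2) j) / (c + 1 + j) := by
    rw [eq_div_iff hcj, ← e5, poch_succ _ (j + 1)]; push_cast; ring
  simp only [hypergeomTerm, e1, e2, e3, e4, e5, e6, poch_succ_left a j, Nat.factorial_succ]
  push_cast
  field_simp
  ring

/-- A contiguous relation for terminating `₂F₁` series. -/
lemma sum_hypergeomTerm_mixed (m : ℕ) (a c z : ℂ) (hc : ∀ k : ℕ, c + k ≠ 0) :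
    (c - a * z) * ∑ j ∈ Finset.range (m + 2), hypergeomTerm (-((m + 1 : ℕ) : ℂ)) a c z j -
        c * ∑ j ∈ Finset.range (m + 3), hypergeomTerm (-((m + 2 : ℕ) : ℂ)) a c z j =
      -((m + 1) * a * (c - a) * z ^ 2 / (c * (c + 1))) *
        ∑ j ∈ Finset.range (m + 1), hypergeomTerm (-(m : ℂ)) (a + 1) (c + 2) z j := by
  have hc0 : c ≠ 0 := by simpa using hc 0
  have hext : ∑ j ∈ Finset.range (m + 2), hypergeomTerm (-((m + 1 : ℕ) : ℂ)) a c z j =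
      ∑ j ∈ Finset.range (m + 3), hypergeomTerm (-((m + 1 : ℕ) : ℂ)) a c z j := by
    rw [Finset.sum_range_succ _ (m + 2)]
    simp [hypergeomTerm, -Nat.cast_add, poch_neg_nat_succ (m + 1)]
  have key := Finset.sum_congr rfl fun j (_ : j ∈ Finset.range (m + 1)) =>
    hypergeomTerm_mixed (-((m + 2 : ℕ) : ℂ)) a c z hc j
  have h1 : -((m + 2 : ℕ) : ℂ) + 1 = -((m + 1 : ℕ) : ℂ) := by push_cast; ring
  have h2 : -((m + 2 : ℕ) : ℂ) + 2 = -(m : ℂ) := by push_cast; ring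
  simp only [h1, h2, Finset.sum_sub_distrib, ← Finset.mul_sum] at key
  have hz : ∀ b, hypergeomTerm b a c z 0 = 1 := fun b => by simp [hypergeomTerm, poch_zero]
  have ho : ∀ b, hypergeomTerm b a c z 1 = b * a / c * z := fun b => by
    simp [hypergeomTerm, poch]
  rw [sub_mul, mul_assoc a z]
  nth_rw 1 [hext]
  rw [Finset.sum_range_succ' _ (m + 2), Finset.sum_range_succ' _ (m + 1),
    Finset.sum_range_succ' (fun j => hypergeomTerm (-((m + 1 : ℕ) : ℂ)) a c z j) (m + 1),
    Finset.sum_range_succ' (fun j => hypergeomTerm (-((m + 2 : ℕ) : ℂ)) a c z j) (m + 2),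
    Finset.sum_range_succ'
      (fun j => hypergeomTerm (-((m + 2 : ℕ) : ℂ)) a c z (j + 1)) (m + 1)]
  simp only [hz, zero_add, ho, add_assoc, Nat.reduceAdd]
  have hcancel : c * (-((m + 1 : ℕ) : ℂ) * a / c * z) - a * z -
      c * (-((m + 2 : ℕ) : ℂ) * a / c * z) = 0 := by
    field_simp
    push_cast
    ring
  push_cast at key hcancel ⊢
  linear_combination key + hcancel

lemma meixnerPollaczek_eq_sum_hypergeomTerm (lam phi : ℝ) (n : ℕ) (x : ℂ) :
    meixnerPollaczek lam phi n x =
      (Complex.I / (1 - Complex.exp (-(2 * Complex.I * phi)))) ^ n * poch (2 * (lam : ℂ)) n *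
        ∑ j ∈ Finset.range (n + 1), hypergeomTerm (-(n : ℂ)) (lam + Complex.I * x)
          (2 * (lam : ℂ)) (1 - Complex.exp (-(2 * Complex.I * phi))) j := by
  have h : Complex.exp (2 * Complex.I * phi) / (Complex.exp (2 * Complex.I * phi) - 1) =
      1 / (1 - Complex.exp (-(2 * Complex.I * phi))) := by
    have hw := Complex.exp_ne_zero (2 * Complex.I * phi)
    rw [Complex.exp_neg, ← mul_div_mul_left 1 _ hw, mul_sub, mul_inv_cancel₀ hw, mul_one]
  simp only [meixnerPollaczek, hypergeomTerm, h]
  ring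

lemma cot_eq_one_sub_exp {phi : ℝ} (h : Real.sin phi ≠ 0) :
    1 - Complex.exp (-(2 * Complex.I * phi)) ≠ 0 ∧
      Complex.cos phi / Complex.sin phi =
        Complex.I * (2 - (1 - Complex.exp (-(2 * Complex.I * phi)))) /
          (1 - Complex.exp (-(2 * Complex.I * phi))) := by
  have hs : Complex.sin phi ≠ 0 := by exact_mod_cast h
  have hu : Complex.exp (-phi * Complex.I) =
      Complex.cos phi - Complex.sin phi * Complex.I := by
    rw [Complex.exp_mul_I, Complex.cos_neg, Complex.sin_neg]
    ring
  have hexp : Complex.exp (-(2 * Complex.I * phi)) =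
      (Complex.cos phi - Complex.sin phi * Complex.I) ^ 2 := by
    rw [← hu, ← Complex.exp_nat_mul]
    congr 1
    push_cast
    ring
  have hsq := Complex.sin_sq_add_cos_sq (phi : ℂ)
  have hz : 1 - Complex.exp (-(2 * Complex.I * phi)) = 2 * Complex.I * Complex.sin phi *
      (Complex.cos phi - Complex.sin phi * Complex.I) := by
    rw [hexp]
    linear_combination (-1) * hsq + Complex.sin phi ^ 2 * Complex.I_sq
  have hne : 1 - Complex.exp (-(2 * Complex.I * phi)) ≠ 0 := by
    rw [hz, ← hu]
    exact mul_ne_zero (mul_ne_zero (mul_ne_zero two_ne_zero Complex.I_ne_zero) hs)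
      (Complex.exp_ne_zero _)
  refine ⟨hne, ?_⟩
  rw [div_eq_div_iff hs hne]
  have hI := Complex.I_sq
  generalize Complex.cos (phi : ℂ) = C at *
  generalize Complex.sin (phi : ℂ) = S at *
  rw [hexp]
  linear_combination (Complex.I * S - C) * hsq + (C * S ^ 2 - Complex.I * S ^ 3) * hI

/-- **Mixed recurrence (3.6):** for `λ > 0`, `0 < φ < π`, `n ≥ 2`,
`[(n−1)(λ²+x²)/(2λ+n−1)]·P_{n−2}^{(λ+1)}(x;φ)
  = (x + λ cos φ/sin φ)·P_{n−1}^{(λ)}(x;φ) − [2λ/(2λ+n−1)]·P_n^{(λ)}(x;φ)`. -/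
theorem meixnerPollaczek_mixed_recurrence_shift_one (lam : ℝ) (hlam : 0 < lam)
    (phi : ℝ) (hphi1 : 0 < phi) (hphi2 : phi < Real.pi)
    (n : ℕ) (hn : 2 ≤ n) (x : ℂ) :
    ((n : ℂ) - 1) * ((lam : ℂ) ^ 2 + x ^ 2) / (2 * (lam : ℂ) + (n : ℂ) - 1) *
        meixnerPollaczek (lam + 1) phi (n - 2) x =
      (x + ((lam * Real.cos phi / Real.sin phi : ℝ) : ℂ)) *
          meixnerPollaczek lam phi (n - 1) x -
        2 * (lam : ℂ) / (2 * (lam : ℂ) + (n : ℂ) - 1) * meixnerPollaczek lam phi n x := by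
  obtain ⟨m, rfl⟩ := Nat.exists_eq_add_of_le' hn
  obtain ⟨hz, hcot⟩ := cot_eq_one_sub_exp (Real.sin_pos_of_pos_of_lt_pi hphi1 hphi2).ne'
  have hc : ∀ k : ℕ, 2 * (lam : ℂ) + k ≠ 0 := fun k => by
    have : 2 * lam + k ≠ 0 := by positivity
    exact_mod_cast this
  have key := sum_hypergeomTerm_mixed m (lam + Complex.I * x) (2 * (lam : ℂ))
    (1 - Complex.exp (-(2 * Complex.I * phi))) hc
  have hc0 : 2 * (lam : ℂ) ≠ 0 := by simpa using hc 0
  have hc1 : 2 * (lam : ℂ) + 1 ≠ 0 := by simpa using hc 1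
  have hcm : 2 * (lam : ℂ) + ((m : ℂ) + 1) ≠ 0 := by exact_mod_cast hc (m + 1)
  have hp : poch (2 * (lam : ℂ)) (m + 2) =
      2 * (lam : ℂ) * ((2 * (lam : ℂ) + 1) * poch (2 * (lam : ℂ) + 2) m) := by
    rw [poch_succ_left, poch_succ_left]; ring_nf
  have hp1 : poch (2 * (lam : ℂ)) (m + 1) =
      2 * (lam : ℂ) * ((2 * (lam : ℂ) + 1) * poch (2 * (lam : ℂ) + 2) m) /
        (2 * (lam : ℂ) + (m + 1)) := by
    rw [eq_div_iff hcm, ← hp, poch_succ _ (m + 1)]; push_cast; ring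
  have hl : 2 * ((lam + 1 : ℝ) : ℂ) = 2 * (lam : ℂ) + 2 := by push_cast; ring
  have ha : ((lam + 1 : ℝ) : ℂ) + Complex.I * x = lam + Complex.I * x + 1 := by
    push_cast; ring
  have hx : (lam : ℂ) ^ 2 + x ^ 2 =
      (lam + Complex.I * x) * (2 * lam - (lam + Complex.I * x)) := by
    linear_combination x ^ 2 * Complex.I_sq
  have hcast : ((lam * Real.cos phi / Real.sin phi : ℝ) : ℂ) =
      lam * (Complex.cos phi / Complex.sin phi) := by
    push_cast; ring
  have hn1 : ((m + 2 : ℕ) : ℂ) - 1 = m + 1 := by push_cast; ring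
  have hn2 : 2 * (lam : ℂ) + ((m + 2 : ℕ) : ℂ) - 1 = 2 * (lam : ℂ) + (m + 1) := by
    push_cast; ring
  have hm1 : m + 2 - 1 = m + 1 := rfl
  simp only [meixnerPollaczek_eq_sum_hypergeomTerm, Nat.add_sub_cancel, hm1, hl, ha, hn1, hn2,
    hcast, hcot, hp, hp1]
  generalize 1 - Complex.exp (-(2 * Complex.I * phi)) = z at *
  have hlin : x + lam * (Complex.I * (2 - z) / z) =
      Complex.I / z * (2 * lam - (lam + Complex.I * x) * z) := by
    field_simp
    linear_combination x * z * Complex.I_sq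
  have hsq : (Complex.I / z) ^ 2 * z ^ 2 = -1 := by
    rw [← mul_pow, div_mul_cancel₀ _ hz, Complex.I_sq]
  rw [hx, hlin]
  generalize lam + Complex.I * x = a at *
  generalize Complex.I / z = q at *
  generalize (∑ j ∈ Finset.range (m + 1), hypergeomTerm (-(m : ℂ)) _ _ z j) = A at *
  generalize (∑ j ∈ Finset.range (m + 1 + 1), hypergeomTerm _ _ _ z j) = B at *
  generalize (∑ j ∈ Finset.range (m + 2 + 1), hypergeomTerm _ _ _ z j) = D at *
  have key' : 2 * (lam : ℂ) * (2 * lam + 1) * ((2 * lam - a * z) * B - 2 * lam * D) =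
      -((m + 1) * a * (2 * lam - a) * z ^ 2 * A) := by
    have hl0 : (lam : ℂ) ≠ 0 := by exact_mod_cast hlam.ne'
    rw [key]
    field_simp
  linear_combination
    -(q ^ (m + 2) * poch (2 * (lam : ℂ) + 2) m / (2 * (lam : ℂ) + (m + 1))) * key' +
      (q ^ m * poch (2 * (lam : ℂ) + 2) m / (2 * (lam : ℂ) + (m + 1)) *
        ((m + 1) * a * (2 * lam - a) * A)) * hsq
end
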